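/- Theorem 1 (Equivalence of models): a reconstruction s* : Fin N → Bool is an RC-optimal solution if and only if (i) s* is RC-feasible, (ii) its change-count tuple χ(s*) is an RC_E-optimal solution, and (iii) cost(s*) equals the RC_E-objective at χ(s*). -/

import Mathlib

open Finset

def G0p {N : ℕ} (sh yh : Fin N → Bool) : Finset (Fin N) :=
  univ.filter (fun i => sh i = false ∧ yh i = true)
def G1p {N : ℕ} (sh yh : Fin N → Bool) : Finset (Fin N) :=
  univ.filter (fun i => sh i = true ∧ yh i = true)
def G0m {N : ℕ} (sh yh : Fin N → Bool) : Finset (Fin N) :=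
  univ.filter (fun i => sh i = false ∧ yh i = false)
def G1m {N : ℕ} (sh yh : Fin N → Bool) : Finset (Fin N) :=
  univ.filter (fun i => sh i = true ∧ yh i = false)

/-- a: changes 0→1 among positively-predicted examples -/
def chgA {N : ℕ} (sh yh s : Fin N → Bool) : ℕ :=
  ((G0p sh yh).filter (fun i => s i = true)).card
/-- b: changes 1→0 among positively-predicted examples -/
def chgB {N : ℕ} (sh yh s : Fin N → Bool) : ℕ :=
  ((G1p sh yh).filter (fun i => s i = false)).card
/-- c: changes 0→1 among negatively-predicted examples -/
def chgC {N : ℕ} (sh yh s : Fin N → Bool) : ℕ :=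
  ((G0m sh yh).filter (fun i => s i = true)).card
/-- d: changes 1→0 among negatively-predicted examples -/
def chgD {N : ℕ} (sh yh s : Fin N → Bool) : ℕ :=
  ((G1m sh yh).filter (fun i => s i = false)).card

/-- RC-feasibility: both protected groups nonempty, and the statistical parity
constraint with tolerance ε holds for each group of the reconstruction s. -/
def RCFeasible {N : ℕ} (yh : Fin N → Bool) (ε : ℝ) (s : Fin N → Bool) : Prop :=
  (univ.filter (fun i => s i = true)).Nonempty ∧
  (univ.filter (fun i => s i = false)).Nonempty ∧
  ∀ g : Bool,
    |((univ.filter (fun i => yh i = true)).card : ℝ) / (N : ℝ) -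
      ((univ.filter (fun i => s i = g ∧ yh i = true)).card : ℝ) /
        ((univ.filter (fun i => s i = g)).card : ℝ)| ≤ ε

/-- RC_E-feasibility of a change-count tuple (a,b,c,d). -/
def RCEFeasible (N k n0p n1p n0m n1m : ℕ) (ε : ℝ) (a b c d : ℕ) : Prop :=
  a ≤ n0p ∧ b ≤ n1p ∧ c ≤ n0m ∧ d ≤ n1m ∧
  a + c < n0p + n0m + b + d ∧
  b + d < n1p + n1m + a + c ∧
  |(k : ℝ) / (N : ℝ) -
    ((n1p : ℝ) - (b : ℝ) + (a : ℝ)) /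
      ((n1p : ℝ) + (n1m : ℝ) - (b : ℝ) - (d : ℝ) + (a : ℝ) + (c : ℝ))| ≤ ε ∧
  |(k : ℝ) / (N : ℝ) -
    ((n0p : ℝ) - (a : ℝ) + (b : ℝ)) /
      ((n0p : ℝ) + (n0m : ℝ) - (a : ℝ) - (c : ℝ) + (b : ℝ) + (d : ℝ))| ≤ ε

/-- Cost of a reconstruction: total confidence of changed positions. -/
def cost {N : ℕ} (sh : Fin N → Bool) (p : Fin N → ℝ) (s : Fin N → Bool) : ℝ :=
  ∑ i ∈ univ.filter (fun i => s i ≠ sh i), p i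

/-- T_G(j): the minimum total confidence of a size-j subset of G
(i.e., the sum of the j smallest confidence scores in G). -/
noncomputable def Tmin {N : ℕ} (G : Finset (Fin N)) (p : Fin N → ℝ) (j : ℕ) : ℝ :=
  sInf {x : ℝ | ∃ A : Finset (Fin N), A ⊆ G ∧ A.card = j ∧ x = ∑ i ∈ A, p i}

/-- The RC_E objective at a change-count tuple (a,b,c,d). -/
noncomputable def objE {N : ℕ} (sh yh : Fin N → Bool) (p : Fin N → ℝ)
    (a b c d : ℕ) : ℝ :=
  Tmin (G0p sh yh) p a + Tmin (G1p sh yh) p b +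
    Tmin (G0m sh yh) p c + Tmin (G1m sh yh) p d

theorem finite_sums_of_card {N : ℕ} (G : Finset (Fin N)) (p : Fin N → ℝ) (j : ℕ) :
    {x : ℝ | ∃ A : Finset (Fin N), A ⊆ G ∧ A.card = j ∧ x = ∑ i ∈ A, p i}.Finite :=
  (Set.finite_range fun A : Finset (Fin N) => ∑ i ∈ A, p i).subset
    fun _ ⟨A, _, _, hx⟩ => ⟨A, hx.symm⟩

theorem Tmin_card_le_sum {N : ℕ} {G A : Finset (Fin N)} (p : Fin N → ℝ) (hA : A ⊆ G) :
    Tmin G p A.card ≤ ∑ i ∈ A, p i :=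
  csInf_le (finite_sums_of_card G p A.card).bddBelow ⟨A, hA, rfl, rfl⟩

theorem exists_sum_eq_Tmin {N : ℕ} {G : Finset (Fin N)} (p : Fin N → ℝ) {j : ℕ}
    (hj : j ≤ G.card) : ∃ A ⊆ G, A.card = j ∧ Tmin G p j = ∑ i ∈ A, p i := by
  obtain ⟨A, hA, hc⟩ := exists_subset_card_eq hj
  have hne : {x : ℝ | ∃ A : Finset (Fin N), A ⊆ G ∧ A.card = j ∧ x = ∑ i ∈ A, p i}.Nonempty :=
    ⟨_, A, hA, hc, rfl⟩
  exact hne.csInf_mem (finite_sums_of_card G p j)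

theorem cost_eq_sum_groups {N : ℕ} (sh yh : Fin N → Bool) (p : Fin N → ℝ) (s : Fin N → Bool) :
    cost sh p s =
      ∑ i ∈ (G0p sh yh).filter (fun i => s i = true), p i +
      ∑ i ∈ (G1p sh yh).filter (fun i => s i = false), p i +
      ∑ i ∈ (G0m sh yh).filter (fun i => s i = true), p i +
      ∑ i ∈ (G1m sh yh).filter (fun i => s i = false), p i := by
  simp only [cost, G0p, G1p, G0m, G1m, filter_filter, sum_filter, ← sum_add_distrib]
  refine sum_congr rfl fun i _ => ?_
  cases sh i <;> cases yh i <;> cases s i <;> simp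

theorem objE_chg_le_cost {N : ℕ} (sh yh : Fin N → Bool) (p : Fin N → ℝ) (s : Fin N → Bool) :
    objE sh yh p (chgA sh yh s) (chgB sh yh s) (chgC sh yh s) (chgD sh yh s) ≤
      cost sh p s := by
  rw [cost_eq_sum_groups sh yh]
  have h (G : Finset (Fin N)) (v : Bool) :
      Tmin G p (G.filter (fun i => s i = v)).card ≤ ∑ i ∈ G.filter (fun i => s i = v), p i :=
    Tmin_card_le_sum p (filter_subset _ _)
  exact add_le_add (add_le_add (add_le_add (h _ _) (h _ _)) (h _ _)) (h _ _)

/-- Within each baseline group a cheapest set of the prescribed size can be flipped. -/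
theorem exists_chg_eq_and_cost_eq_objE {N : ℕ} (sh yh : Fin N → Bool) (p : Fin N → ℝ)
    {a b c d : ℕ} (ha : a ≤ (G0p sh yh).card) (hb : b ≤ (G1p sh yh).card)
    (hc : c ≤ (G0m sh yh).card) (hd : d ≤ (G1m sh yh).card) :
    ∃ s : Fin N → Bool, chgA sh yh s = a ∧ chgB sh yh s = b ∧ chgC sh yh s = c ∧
      chgD sh yh s = d ∧ cost sh p s = objE sh yh p a b c d := by
  obtain ⟨A, hA, hAc, hAs⟩ := exists_sum_eq_Tmin p ha
  obtain ⟨B, hB, hBc, hBs⟩ := exists_sum_eq_Tmin p hb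
  obtain ⟨C, hC, hCc, hCs⟩ := exists_sum_eq_Tmin p hc
  obtain ⟨D, hD, hDc, hDs⟩ := exists_sum_eq_Tmin p hd
  let s : Fin N → Bool := fun i =>
    if sh i then decide (i ∉ B ∧ i ∉ D) else decide (i ∈ A ∨ i ∈ C)
  have hA' i (h : i ∈ A) : sh i = false ∧ yh i = true := by simpa [G0p] using hA h
  have hB' i (h : i ∈ B) : sh i = true ∧ yh i = true := by simpa [G1p] using hB h
  have hC' i (h : i ∈ C) : sh i = false ∧ yh i = false := by simpa [G0m] using hC h
  have hD' i (h : i ∈ D) : sh i = true ∧ yh i = false := by simpa [G1m] using hD h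
  have eA : (G0p sh yh).filter (fun i => s i = true) = A := by
    ext i
    simp only [G0p, mem_filter, mem_univ, true_and, s]
    grind
  have eB : (G1p sh yh).filter (fun i => s i = false) = B := by
    ext i
    simp only [G1p, mem_filter, mem_univ, true_and, s]
    grind
  have eC : (G0m sh yh).filter (fun i => s i = true) = C := by
    ext i
    simp only [G0m, mem_filter, mem_univ, true_and, s]
    grind
  have eD : (G1m sh yh).filter (fun i => s i = false) = D := by
    ext i
    simp only [G1m, mem_filter, mem_univ, true_and, s]
    grind
  refine ⟨s, by rw [chgA, eA, hAc], by rw [chgB, eB, hBc], by rw [chgC, eC, hCc],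
    by rw [chgD, eD, hDc], ?_⟩
  rw [cost_eq_sum_groups sh yh, eA, eB, eC, eD, objE, hAs, hBs, hCs, hDs]

theorem card_true_pos_add_chgB {N : ℕ} (sh yh s : Fin N → Bool) :
    (univ.filter (fun i => s i = true ∧ yh i = true)).card + chgB sh yh s =
      (G1p sh yh).card + chgA sh yh s := by
  simp only [chgA, chgB, G0p, G1p, filter_filter, card_filter, ← sum_add_distrib]
  refine sum_congr rfl fun i _ => ?_
  cases sh i <;> cases yh i <;> cases s i <;> simp

theorem card_false_pos_add_chgA {N : ℕ} (sh yh s : Fin N → Bool) :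
    (univ.filter (fun i => s i = false ∧ yh i = true)).card + chgA sh yh s =
      (G0p sh yh).card + chgB sh yh s := by
  simp only [chgA, chgB, G0p, G1p, filter_filter, card_filter, ← sum_add_distrib]
  refine sum_congr rfl fun i _ => ?_
  cases sh i <;> cases yh i <;> cases s i <;> simp

theorem card_true_add_chgB_add_chgD {N : ℕ} (sh yh s : Fin N → Bool) :
    (univ.filter (fun i => s i = true)).card + chgB sh yh s + chgD sh yh s =
      (G1p sh yh).card + (G1m sh yh).card + chgA sh yh s + chgC sh yh s := by
  simp only [chgA, chgB, chgC, chgD, G0p, G1p, G0m, G1m, filter_filter, card_filter,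
    ← sum_add_distrib]
  refine sum_congr rfl fun i _ => ?_
  cases sh i <;> cases yh i <;> cases s i <;> simp

theorem card_false_add_chgA_add_chgC {N : ℕ} (sh yh s : Fin N → Bool) :
    (univ.filter (fun i => s i = false)).card + chgA sh yh s + chgC sh yh s =
      (G0p sh yh).card + (G0m sh yh).card + chgB sh yh s + chgD sh yh s := by
  simp only [chgA, chgB, chgC, chgD, G0p, G1p, G0m, G1m, filter_filter, card_filter,
    ← sum_add_distrib]
  refine sum_congr rfl fun i _ => ?_
  cases sh i <;> cases yh i <;> cases s i <;> simp

theorem RCFeasible_iff_RCEFeasible_chg {N : ℕ} (sh yh : Fin N → Bool) (ε : ℝ)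
    (s : Fin N → Bool) :
    RCFeasible yh ε s ↔
      RCEFeasible N (univ.filter (fun i => yh i = true)).card
        (G0p sh yh).card (G1p sh yh).card (G0m sh yh).card (G1m sh yh).card ε
        (chgA sh yh s) (chgB sh yh s) (chgC sh yh s) (chgD sh yh s) := by
  have h1 := card_true_pos_add_chgB sh yh s
  have h2 := card_false_pos_add_chgA sh yh s
  have h3 := card_true_add_chgB_add_chgD sh yh s
  have h4 := card_false_add_chgA_add_chgC sh yh s
  have e1 : ((G1p sh yh).card : ℝ) - chgB sh yh s + chgA sh yh s =
      (univ.filter (fun i => s i = true ∧ yh i = true)).card := by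
    linarith [(by exact_mod_cast h1 : ((univ.filter (fun i => s i = true ∧ yh i = true)).card : ℝ)
      + chgB sh yh s = (G1p sh yh).card + chgA sh yh s)]
  have e2 : ((G0p sh yh).card : ℝ) - chgA sh yh s + chgB sh yh s =
      (univ.filter (fun i => s i = false ∧ yh i = true)).card := by
    linarith [(by exact_mod_cast h2 : ((univ.filter (fun i => s i = false ∧ yh i = true)).card : ℝ)
      + chgA sh yh s = (G0p sh yh).card + chgB sh yh s)]
  have e3 : ((G1p sh yh).card : ℝ) + (G1m sh yh).card - chgB sh yh s - chgD sh yh s +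
      chgA sh yh s + chgC sh yh s = (univ.filter (fun i => s i = true)).card := by
    linarith [(by exact_mod_cast h3 : ((univ.filter (fun i => s i = true)).card : ℝ)
      + chgB sh yh s + chgD sh yh s =
        (G1p sh yh).card + (G1m sh yh).card + chgA sh yh s + chgC sh yh s)]
  have e4 : ((G0p sh yh).card : ℝ) + (G0m sh yh).card - chgA sh yh s - chgC sh yh s +
      chgB sh yh s + chgD sh yh s = (univ.filter (fun i => s i = false)).card := by
    linarith [(by exact_mod_cast h4 : ((univ.filter (fun i => s i = false)).card : ℝ)
      + chgA sh yh s + chgC sh yh s =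
        (G0p sh yh).card + (G0m sh yh).card + chgB sh yh s + chgD sh yh s)]
  have hA : chgA sh yh s ≤ (G0p sh yh).card := card_filter_le _ _
  have hB : chgB sh yh s ≤ (G1p sh yh).card := card_filter_le _ _
  have hC : chgC sh yh s ≤ (G0m sh yh).card := card_filter_le _ _
  have hD : chgD sh yh s ≤ (G1m sh yh).card := card_filter_le _ _
  rw [RCFeasible, RCEFeasible, e1, e2, e3, e4, ← card_pos, ← card_pos, Bool.forall_bool]
  constructor
  · rintro ⟨ht, hf, hF, hT⟩
    exact ⟨hA, hB, hC, hD, by omega, by omega, hT, hF⟩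
  · rintro ⟨-, -, -, -, hf, ht, hT, hF⟩
    exact ⟨by omega, by omega, hF, hT⟩

theorem equivalence_of_models (N : ℕ) (hN : 1 ≤ N)
    (sh yh : Fin N → Bool) (p : Fin N → ℝ) (hp : ∀ i, 0 ≤ p i)
    (ε : ℝ) (hε : 0 ≤ ε) (s : Fin N → Bool) :
    (RCFeasible yh ε s ∧
      ∀ s' : Fin N → Bool, RCFeasible yh ε s' → cost sh p s ≤ cost sh p s') ↔
    (RCFeasible yh ε s ∧
      (RCEFeasible N (univ.filter (fun i => yh i = true)).card
        (G0p sh yh).card (G1p sh yh).card (G0m sh yh).card (G1m sh yh).card ε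
        (chgA sh yh s) (chgB sh yh s) (chgC sh yh s) (chgD sh yh s) ∧
       ∀ a b c d : ℕ,
        RCEFeasible N (univ.filter (fun i => yh i = true)).card
          (G0p sh yh).card (G1p sh yh).card (G0m sh yh).card (G1m sh yh).card ε
          a b c d →
        objE sh yh p (chgA sh yh s) (chgB sh yh s) (chgC sh yh s) (chgD sh yh s) ≤
          objE sh yh p a b c d) ∧
      cost sh p s =
        objE sh yh p (chgA sh yh s) (chgB sh yh s) (chgC sh yh s) (chgD sh yh s)) := by
  constructor
  · rintro ⟨hs, hmin⟩
    have hmin' : ∀ a b c d : ℕ,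
        RCEFeasible N (univ.filter (fun i => yh i = true)).card
          (G0p sh yh).card (G1p sh yh).card (G0m sh yh).card (G1m sh yh).card ε
          a b c d →
        cost sh p s ≤ objE sh yh p a b c d := by
      intro a b c d h
      obtain ⟨s', rfl, rfl, rfl, rfl, hcost⟩ :=
        exists_chg_eq_and_cost_eq_objE sh yh p h.1 h.2.1 h.2.2.1 h.2.2.2.1
      exact hcost ▸ hmin s' ((RCFeasible_iff_RCEFeasible_chg sh yh ε s').2 h)
    have hE := (RCFeasible_iff_RCEFeasible_chg sh yh ε s).1 hs
    have hle := objE_chg_le_cost sh yh p s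
    exact ⟨hs, ⟨hE, fun a b c d h => hle.trans (hmin' a b c d h)⟩,
      (hmin' _ _ _ _ hE).antisymm hle⟩
  · rintro ⟨hs, ⟨-, hmin⟩, hcost⟩
    refine ⟨hs, fun s' hs' => ?_⟩
    rw [hcost]
    exact (hmin _ _ _ _ ((RCFeasible_iff_RCEFeasible_chg sh yh ε s').1 hs')).trans
      (objE_chg_le_cost sh yh p s')
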